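/- arXiv:2301.06491 — 4 statements merged into one kernel-verified Lean document; each statement's English description precedes it below -/
import Mathlib

section
/- Let n ≥ 1 and 1 ≤ k ≤ n. Define G on n×n real matrices by G(A) = s_k(A)^{1/k}, where s_k(A) = (−1)^k times the coefficient of X^{n−k} in the characteristic polynomial of A (so s_k(A) is the k-th elementary symmetric function of the eigenvalues of A, a polynomial in the entries of A). Let b be a symmetric positive-definite n×n real matrix (so s_k(b) > 0 and G is smooth in a neighborhood of b). Then for every symmetric n×n real matrix η, D²G(b)(η, η) + 2 · DG(b)(η b⁻¹ η) ≥ 2 · G(b)⁻¹ · (DG(b)(η))², where DG(b) and D²G(b) denote the first and second Fréchet derivatives of G at b. (In index notation this is the inequality (G̈^{pq,lm} + 2 Ġ^{pm} h^{ql}) η_{pq} η_{lm} ≥ 2 G⁻¹ (Ġ^{pq} η_{pq})², with h = b⁻¹.) -/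
attribute [local instance] Matrix.normedAddCommGroup Matrix.normedSpace

/-- `s_k(A)`: the `k`-th elementary symmetric function of the eigenvalues of `A`,
defined as `(−1)^k` times the coefficient of `X^{n−k}` in the characteristic polynomial. -/
noncomputable def sk (n k : ℕ) (A : Matrix (Fin n) (Fin n) ℝ) : ℝ :=
  (-1 : ℝ) ^ k * (Matrix.charpoly A).coeff (n - k)

/-- `G(A) = s_k(A)^{1/k}`. -/
noncomputable def Gfun (n k : ℕ) (A : Matrix (Fin n) (Fin n) ℝ) : ℝ :=
  sk n k A ^ ((1 : ℝ) / (k : ℝ))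

open Polynomial Matrix in
/-- The second-order jet at `0` of `det (1 + t A + t² B)`. -/
theorem coeff_det_one_add_quadratic {R m : Type*} [CommRing R] [Fintype m] [DecidableEq m]
    (A B : Matrix m m R) :
    (det (1 + (X : R[X]) • A.map C + (X : R[X]) ^ 2 • B.map C)).coeff 0 = 1 ∧
    (det (1 + (X : R[X]) • A.map C + (X : R[X]) ^ 2 • B.map C)).coeff 1 = A.trace ∧
    2 * (det (1 + (X : R[X]) • A.map C + (X : R[X]) ^ 2 • B.map C)).coeff 2 =
      A.trace ^ 2 - (A * A).trace + 2 * B.trace := by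
  set M : Matrix m m R[X] := 1 + (X : R[X]) • A.map C + (X : R[X]) ^ 2 • B.map C with hM
  have htr : ∀ N : Matrix m m R, (N.map C).trace = C N.trace := fun N => by
    simp [trace, map_sum]
  obtain ⟨q, hq⟩ : ∃ q : R[X], M.det = 1 + (C A.trace + X * C B.trace) * X + q * X ^ 2 := by
    have h := det_one_add_smul (X : R[X]) (A.map C + (X : R[X]) • B.map C)
    rw [trace_add, trace_smul, htr, htr, smul_eq_mul] at h
    refine ⟨_, Eq.trans ?_ h⟩
    rw [hM, smul_add, smul_smul, add_assoc, sq]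
  have h0 : M.det.coeff 0 = 1 := by simp [hq]
  have h1 : M.det.coeff 1 = A.trace := by
    rw [hq]
    simp [coeff_mul_X_pow', coeff_one]
  refine ⟨h0, h1, ?_⟩
  set M' : Matrix m m R[X] := 1 - (X : R[X]) • A.map C + (X : R[X]) ^ 2 • B.map C with hM'
  have hcomp : M'.det = M.det.comp (-X) := by
    have := (compRingHom (-X : R[X])).map_det M
    rw [coe_compRingHom_apply] at this
    rw [this]
    congr 1
    ext1 i j
    by_cases hij : i = j <;> simp [hM, hM', hij, one_apply, sub_eq_add_neg]
  obtain ⟨q', hq'⟩ : ∃ q : R[X], M.det * M'.det =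
      1 + (C (2 * B.trace - (A * A).trace) +
        X * (X * C (B * B).trace)) * X ^ 2 + q * X ^ 4 := by
    have h := det_one_add_smul ((X : R[X]) ^ 2)
      ((2 : R[X]) • B.map C - (A * A).map C + (X : R[X]) • (A.map C * B.map C - B.map C * A.map C)
        + (X : R[X]) ^ 2 • (B * B).map C)
    rw [← pow_mul, trace_add, trace_add, trace_sub, trace_smul, trace_smul, trace_smul, htr, htr,
      htr, trace_sub, trace_mul_comm (B.map C) (A.map C), sub_self, smul_zero, add_zero] at h
    have h2 : (C (2 * B.trace - (A * A).trace) + X * (X * C (B * B).trace) : R[X]) =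
      (2 : R[X]) • C B.trace - C (A * A).trace + (X : R[X]) ^ 2 • C (B * B).trace := by
      simp only [map_sub, smul_eq_mul, two_mul, map_add]
      ring
    rw [h2]
    refine ⟨_, Eq.trans ?_ h⟩
    rw [← det_mul]
    congr 1
    rw [hM, hM', Matrix.map_mul, Matrix.map_mul]
    simp only [mul_add, add_mul, mul_sub, Matrix.mul_one, Matrix.one_mul, smul_add,
      smul_sub, Matrix.smul_mul, Matrix.mul_smul, smul_smul]
    module
  have hc2 := congrArg (fun p : R[X] => p.coeff 2) hq'
  have hl : (M.det * M'.det).coeff 2 = 2 * M.det.coeff 2 - M.det.coeff 1 ^ 2 := by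
    have hcc : ∀ k, M'.det.coeff k = M.det.coeff k * (-1) ^ k := fun k => by
      rw [hcomp, show (-X : R[X]) = C (-1) * X by simp, comp_C_mul_X_coeff]
    rw [coeff_mul, Finset.Nat.antidiagonal_succ]
    simp [Finset.Nat.antidiagonal_succ, hcc, h0]
    ring
  have hr : (1 + (C (2 * B.trace - (A * A).trace) +
        X * (X * C (B * B).trace)) * X ^ 2 + q' * X ^ 4 : R[X]).coeff 2 =
        2 * B.trace - (A * A).trace := by
    simp [coeff_mul_X_pow', coeff_one]
  beta_reduce at hc2
  rw [hl] at hc2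
  rw [hr, h1] at hc2
  linear_combination hc2

open Polynomial Matrix in
/-- The estimate for a single determinant along a quadratic curve through a positive diagonal
matrix. -/
theorem coeff_det_diagonal_add_quadratic {m : Type*} [Fintype m] [DecidableEq m]
    (l : m → ℝ) (hl : ∀ i, 0 < l i) (Q R : Matrix m m ℝ) (hQ : Q.IsSymm)
    (hR : ∀ i, ∑ j, Q i j ^ 2 / l j ≤ R i i) :
    0 < (det ((diagonal l).map C + (X : ℝ[X]) • Q.map C + (X : ℝ[X]) ^ 2 • R.map C)).coeff 0 ∧
    (Fintype.card m + 1) *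
      (det ((diagonal l).map C + (X : ℝ[X]) • Q.map C + (X : ℝ[X]) ^ 2 • R.map C)).coeff 1 ^ 2 ≤
    2 * Fintype.card m *
      (det ((diagonal l).map C + (X : ℝ[X]) • Q.map C + (X : ℝ[X]) ^ 2 • R.map C)).coeff 0 *
      (det ((diagonal l).map C + (X : ℝ[X]) • Q.map C + (X : ℝ[X]) ^ 2 • R.map C)).coeff 2 := by
  set A : Matrix m m ℝ := of fun i j => Q i j / l i with hA
  set B : Matrix m m ℝ := of fun i j => R i j / l i with hB
  have hfac : (diagonal l).map C + (X : ℝ[X]) • Q.map C + (X : ℝ[X]) ^ 2 • R.map C =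
      diagonal (fun i => C (l i)) * (1 + (X : ℝ[X]) • A.map C + (X : ℝ[X]) ^ 2 • B.map C) := by
    ext1 i j
    have h1 : (C (l i) : ℝ[X]) * C (Q i j / l i) = C (Q i j) := by
      rw [← C_mul, mul_div_cancel₀ _ (hl i).ne']
    have h2 : (C (l i) : ℝ[X]) * C (R i j / l i) = C (R i j) := by
      rw [← C_mul, mul_div_cancel₀ _ (hl i).ne']
    rw [diagonal_mul]
    simp only [Matrix.add_apply, Matrix.smul_apply, map_apply, smul_eq_mul, hA, hB, of_apply, one_apply,
      diagonal_apply]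
    rw [← h1, ← h2]
    split_ifs <;> simp <;> ring
  obtain ⟨h0, h1, h2⟩ := coeff_det_one_add_quadratic A B
  have hprod : (∏ i, C (l i) : ℝ[X]) = C (∏ i, l i) := by rw [map_prod]
  have hpos : 0 < ∏ i, l i := Finset.prod_pos fun i _ => hl i
  rw [hfac, det_mul, det_diagonal, hprod, coeff_C_mul, coeff_C_mul, coeff_C_mul, h0, h1]
  refine ⟨by linarith, ?_⟩
  have hAA : (A * A).trace = ∑ i, ∑ j, Q i j ^ 2 / (l i * l j) := by
    simp only [trace, diag_apply, mul_apply, hA, of_apply]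
    refine Finset.sum_congr rfl fun i _ => Finset.sum_congr rfl fun j _ => ?_
    rw [hQ.apply i j, sq, div_mul_div_comm]
  have hBt : (A * A).trace ≤ B.trace := by
    rw [hAA]
    refine Finset.sum_le_sum fun i _ => ?_
    simp only [diag_apply, hB, of_apply]
    rw [le_div_iff₀ (hl i), Finset.sum_mul]
    refine (Finset.sum_le_sum fun j _ => le_of_eq ?_).trans (hR i)
    have := (hl i).ne'
    have := (hl j).ne'
    field_simp
  have hAt : A.trace ^ 2 ≤ Fintype.card m * (A * A).trace := by
    have h := sq_sum_le_card_mul_sum_sq (s := Finset.univ) (f := fun i => A i i)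
    refine h.trans (mul_le_mul_of_nonneg_left ?_ (Nat.cast_nonneg _))
    rw [hAA]
    refine Finset.sum_le_sum fun i _ => ?_
    have : A i i ^ 2 = Q i i ^ 2 / (l i * l i) := by
      simp only [hA, of_apply, sq, div_mul_div_comm]
    rw [this]
    exact Finset.single_le_sum (f := fun j => Q i j ^ 2 / (l i * l j))
      (fun j _ => div_nonneg (sq_nonneg _) (mul_pos (hl i) (hl j)).le) (Finset.mem_univ i)
  set c := (det (1 + (X : ℝ[X]) • A.map C + (X : ℝ[X]) ^ 2 • B.map C)).coeff 2
  have hcard : (0 : ℝ) ≤ Fintype.card m := Nat.cast_nonneg _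
  have key : (Fintype.card m + 1) * A.trace ^ 2 ≤ 2 * Fintype.card m * c := by
    have := mul_le_mul_of_nonneg_left hBt hcard
    calc _ = Fintype.card m * A.trace ^ 2 + A.trace ^ 2 := by ring
      _ ≤ Fintype.card m * (A.trace ^ 2 - (A * A).trace + 2 * B.trace) := by linarith
      _ = 2 * Fintype.card m * c := by rw [← h2]; ring
  have := mul_le_mul_of_nonneg_left key (sq_nonneg (∏ i, l i))
  linarith

theorem sk_eq_sum_minors {n k : ℕ} (hkn : k ≤ n) (A : Matrix (Fin n) (Fin n) ℝ) :
    sk n k A = ∑ s ∈ Finset.univ.powersetCard k,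
      (A.submatrix (Subtype.val : s → Fin n) (Subtype.val : s → Fin n)).det := by
  have h := Matrix.charpoly_coeff_eq_sum_minors A k (by simpa using hkn)
  rw [Fintype.card_fin] at h
  rw [sk, h, ← mul_assoc, ← mul_pow]
  simp

open Polynomial in
theorem exists_polynomial_sk_diagonal {n k : ℕ} (hk : 1 ≤ k) (hkn : k ≤ n)
    (l : Fin n → ℝ) (hl : ∀ i, 0 < l i) (Q R : Matrix (Fin n) (Fin n) ℝ) (hQ : Q.IsSymm)
    (hR : ∀ i, ∑ j, Q i j ^ 2 / l j = R i i) :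
    ∃ p : ℝ[X], (∀ t : ℝ, sk n k (Matrix.diagonal l + t • Q + t ^ 2 • R) = p.eval t) ∧
      0 < p.coeff 0 ∧ (k + 1) * p.coeff 1 ^ 2 ≤ 2 * k * p.coeff 0 * p.coeff 2 := by
  let v (s : Finset (Fin n)) : s → Fin n := Subtype.val
  let q (s : Finset (Fin n)) : ℝ[X] := Matrix.det
    ((Matrix.diagonal fun i => l (v s i)).map C + (X : ℝ[X]) • (Q.submatrix (v s) (v s)).map C +
      (X : ℝ[X]) ^ 2 • (R.submatrix (v s) (v s)).map C)
  have hq : ∀ s ∈ Finset.univ.powersetCard k, 0 < (q s).coeff 0 ∧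
      (k + 1) * (q s).coeff 1 ^ 2 ≤ 2 * k * (q s).coeff 0 * (q s).coeff 2 := by
    intro s hs
    have h := coeff_det_diagonal_add_quadratic (fun i => l (v s i)) (fun i => hl _)
      (Q.submatrix (v s) (v s)) (R.submatrix (v s) (v s)) (hQ.submatrix _) (fun i => by
        simp only [Matrix.submatrix_apply, ← hR]
        rw [Finset.univ_eq_attach, Finset.sum_attach s (fun j => Q (v s i) j ^ 2 / l j)]
        exact Finset.sum_le_univ_sum_of_nonneg fun j => div_nonneg (sq_nonneg _) (hl j).le)
    rwa [Fintype.card_coe, (Finset.mem_powersetCard.mp hs).2] at h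
  have hne : (Finset.univ.powersetCard k : Finset (Finset (Fin n))).Nonempty :=
    Finset.powersetCard_nonempty.2 (by simpa using hkn)
  have hk0 : (0 : ℝ) < k := by exact_mod_cast hk
  refine ⟨∑ s ∈ Finset.univ.powersetCard k, q s, fun t => ?_, ?_, ?_⟩
  · rw [sk_eq_sum_minors hkn, eval_finsetSum]
    refine Finset.sum_congr rfl fun s _ => ?_
    rw [← coe_evalRingHom, RingHom.map_det]
    congr 1
    ext i j
    by_cases hij : i = j
    · simp [hij, v, mul_comm t, mul_comm (t ^ 2)]
    · simp [hij, v, Subtype.val_injective.eq_iff, mul_comm t, mul_comm (t ^ 2)]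
  · rw [finsetSum_coeff]
    exact Finset.sum_pos (fun s hs => (hq s hs).1) hne
  · simp only [finsetSum_coeff]
    have h := Finset.sum_sq_le_sum_mul_sum_of_sq_le_mul (Finset.univ.powersetCard k)
      (r := fun s => (q s).coeff 1) (f := fun s => (q s).coeff 0)
      (g := fun s => 2 * k / (k + 1) * (q s).coeff 2)
      (fun s hs => (hq s hs).1.le) (fun s hs => ?_) (fun s hs => ?_)
    · rw [← Finset.mul_sum] at h
      have := mul_le_mul_of_nonneg_left h (by positivity : (0 : ℝ) ≤ k + 1)
      refine this.trans (le_of_eq ?_)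
      field_simp
    · have h1 := (hq s hs).1
      have h2 : 0 ≤ 2 * k * (q s).coeff 0 * (q s).coeff 2 :=
        le_trans (by positivity) (hq s hs).2
      have h3 : 0 ≤ (q s).coeff 2 := nonneg_of_mul_nonneg_right h2 (by positivity)
      positivity
    · have := (hq s hs).2
      rw [← mul_le_mul_iff_right₀ (by positivity : (0 : ℝ) < k + 1)]
      refine this.trans (le_of_eq ?_)
      field_simp

open Polynomial in
theorem exists_polynomial_sk {n k : ℕ} (hk : 1 ≤ k) (hkn : k ≤ n)
    (b : Matrix (Fin n) (Fin n) ℝ) (hb : b.PosDef) (η : Matrix (Fin n) (Fin n) ℝ)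
    (hη : η.IsSymm) :
    ∃ p : ℝ[X], (∀ t : ℝ, sk n k (b + t • η + t ^ 2 • (η * b⁻¹ * η)) = p.eval t) ∧
      0 < p.coeff 0 ∧ (k + 1) * p.coeff 1 ^ 2 ≤ 2 * k * p.coeff 0 * p.coeff 2 := by
  have hH := hb.isHermitian
  set l := hH.eigenvalues
  have hl : ∀ i, 0 < l i := hb.eigenvalues_pos
  set U : Matrix (Fin n) (Fin n) ℝ := (hH.eigenvectorUnitary : Matrix (Fin n) (Fin n) ℝ)
  have hUU : U * U.transpose = 1 := by
    simpa [Matrix.star_eq_conjTranspose] using Unitary.coe_mul_star_self hH.eigenvectorUnitary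
  have hUU' : U.transpose * U = 1 := by
    simpa [Matrix.star_eq_conjTranspose] using Unitary.coe_star_mul_self hH.eigenvectorUnitary
  have hbd : b = U * Matrix.diagonal l * U.transpose := by
    have h := hH.spectral_theorem
    rw [Unitary.conjStarAlgAut_apply] at h
    simpa [Matrix.star_eq_conjTranspose] using h
  have hbinv : b⁻¹ = U * Matrix.diagonal (fun i => (l i)⁻¹) * U.transpose := by
    apply Matrix.inv_eq_right_inv
    rw [hbd]
    calc _ = U * Matrix.diagonal l * (U.transpose * U) * Matrix.diagonal (fun i => (l i)⁻¹)
          * U.transpose := by simp only [Matrix.mul_assoc]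
      _ = 1 := by
        rw [hUU', Matrix.mul_one, Matrix.mul_assoc U, Matrix.diagonal_mul_diagonal]
        simp [(hl _).ne', hUU]
  set Q := U.transpose * η * U with hQ
  set R := Q * Matrix.diagonal (fun i => (l i)⁻¹) * Q with hR
  have hQs : Q.IsSymm := by
    rw [Matrix.IsSymm, hQ]
    simp [Matrix.transpose_mul, hη.eq, Matrix.mul_assoc]
  obtain ⟨p, hp, hrest⟩ := exists_polynomial_sk_diagonal hk hkn l hl Q R hQs (fun i => by
    rw [hR, Matrix.mul_apply]
    refine Finset.sum_congr rfl fun j _ => ?_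
    rw [Matrix.mul_diagonal, hQs.apply i j]
    ring)
  refine ⟨p, fun t => ?_, hrest⟩
  rw [← hp]
  have hηQ : η = U * Q * U.transpose := by
    calc η = (U * U.transpose) * η * (U * U.transpose) := by simp [hUU]
      _ = _ := by simp only [hQ, Matrix.mul_assoc]
  have hζ : η * b⁻¹ * η = U * R * U.transpose := by
    calc η * b⁻¹ * η = U * Q * (U.transpose * U) * Matrix.diagonal (fun i => (l i)⁻¹)
          * (U.transpose * U) * Q * U.transpose := by
          rw [hbinv, hηQ]
          simp only [Matrix.mul_assoc]
      _ = _ := by simp only [hUU', Matrix.mul_one, hR, Matrix.mul_assoc]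
  have : b + t • η + t ^ 2 • (η * b⁻¹ * η) =
      U * (Matrix.diagonal l + t • Q + t ^ 2 • R) * U.transpose := by
    rw [hζ]
    nth_rewrite 1 [hbd]
    nth_rewrite 1 [hηQ]
    simp only [Matrix.mul_add, Matrix.add_mul, Matrix.mul_smul, Matrix.smul_mul]
  rw [this, sk, sk, Matrix.charpoly_mul_comm, ← Matrix.mul_assoc, hUU', Matrix.one_mul]

theorem contDiff_sk {n k : ℕ} (hkn : k ≤ n) : ContDiff ℝ 2 (sk n k) := by
  have h : sk n k = _ := funext fun A => sk_eq_sum_minors hkn A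
  rw [h]
  refine ContDiff.sum fun s _ => ?_
  simp only [Matrix.det_apply']
  refine ContDiff.sum fun σ _ => contDiff_const.mul (contDiff_prod fun i _ => ?_)
  exact contDiff_apply_apply ℝ ℝ _ _

open Polynomial in
/-- If a polynomial satisfies `(k + 1) p'² ≤ k p p''` at `0`, then `2 (q')² ≤ q q''` at `0`
for `q = p ^ (1 / k)`. -/
theorem rpow_polynomial_second_deriv {k : ℕ} (hk : 1 ≤ k) (p : ℝ[X]) (h0 : 0 < p.coeff 0)
    (hp : (k + 1) * p.coeff 1 ^ 2 ≤ 2 * k * p.coeff 0 * p.coeff 2) :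
    2 * ((p.eval 0) ^ ((1 : ℝ) / k))⁻¹ *
        (deriv (fun t => (p.eval t) ^ ((1 : ℝ) / k)) 0) ^ 2 ≤
      deriv (deriv fun t => (p.eval t) ^ ((1 : ℝ) / k)) 0 := by
  set a : ℝ := 1 / k with ha
  have hk0 : (0 : ℝ) < k := by exact_mod_cast hk
  have e0 : p.eval 0 = p.coeff 0 := (coeff_zero_eq_eval_zero p).symm
  have e1 : p.derivative.eval 0 = p.coeff 1 := by
    rw [← coeff_zero_eq_eval_zero, coeff_derivative]; simp
  have e2 : p.derivative.derivative.eval 0 = 2 * p.coeff 2 := by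
    rw [← coeff_zero_eq_eval_zero, coeff_derivative, coeff_derivative]; norm_num; ring
  have hpos : ∀ᶠ t in nhds (0 : ℝ), 0 < p.eval t :=
    p.continuous.continuousAt.eventually (lt_mem_nhds (h0.trans_eq e0.symm))
  have hd : ∀ t, 0 < p.eval t → HasDerivAt (fun t => (p.eval t) ^ a)
      (p.derivative.eval t * a * (p.eval t) ^ (a - 1)) t := fun t ht =>
    (p.hasDerivAt t).rpow_const (Or.inl ht.ne')
  have hd1 : deriv (fun t => (p.eval t) ^ a) =ᶠ[nhds 0]
      fun t => p.derivative.eval t * a * (p.eval t) ^ (a - 1) :=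
    hpos.mono fun t ht => (hd t ht).deriv
  have h0' : 0 < p.eval 0 := by rwa [e0]
  have hd2 : HasDerivAt (fun t => p.derivative.eval t * a * (p.eval t) ^ (a - 1)) _ 0 :=
    ((p.derivative.hasDerivAt 0).mul_const a).mul
      ((p.hasDerivAt 0).rpow_const (p := a - 1) (Or.inl h0'.ne'))
  rw [hd1.deriv_eq, hd1.eq_of_nhds]
  rw [hd2.deriv, e0, e1, e2]
  set c := p.coeff 0
  set d := p.coeff 1
  have r1 : c ^ (a - 1) = c ^ a / c := by rw [Real.rpow_sub h0, Real.rpow_one]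
  have r2 : c ^ (a - 1 - 1) = c ^ a / c / c := by
    rw [Real.rpow_sub h0, Real.rpow_one, r1]
  rw [r1, r2]
  have hg : 0 < c ^ a := Real.rpow_pos_of_pos h0 a
  set g := c ^ a
  have hdiff : 2 * p.coeff 2 * a * (g / c) + d * a * (d * (a - 1) * (g / c / c)) -
      2 * g⁻¹ * (d * a * (g / c)) ^ 2 =
      g / (c ^ 2 * k ^ 2) * (2 * k * c * p.coeff 2 - (k + 1) * d ^ 2) := by
    rw [ha]
    field_simp
    ring
  have : 0 ≤ g / (c ^ 2 * k ^ 2) * (2 * k * c * p.coeff 2 - (k + 1) * d ^ 2) :=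
    mul_nonneg (by positivity) (by linarith)
  linarith

/-- First and second derivatives of a `C²` function along a quadratic curve. -/
theorem deriv_comp_quadratic {E : Type*} [NormedAddCommGroup E] [NormedSpace ℝ E] {f : E → ℝ}
    {x : E} (hf : ContDiffAt ℝ 2 f x) (v w : E) :
    deriv (fun t : ℝ => f (x + t • v + t ^ 2 • w)) 0 = fderiv ℝ f x v ∧
    deriv (deriv fun t : ℝ => f (x + t • v + t ^ 2 • w)) 0 =
      fderiv ℝ (fderiv ℝ f) x v v + 2 * fderiv ℝ f x w := by
  have hγ : ∀ t : ℝ, HasDerivAt (fun t : ℝ => x + t • v + t ^ 2 • w) (v + (2 * t) • w) t := by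
    intro t
    have h1 := (hasDerivAt_id t).smul_const v
    have h2 := (hasDerivAt_pow 2 t).smul_const w
    convert! (h1.const_add x).add h2 using 1
    simp
  have hγ0 : x + (0 : ℝ) • v + (0 : ℝ) ^ 2 • w = x := by simp
  have hev : ∀ᶠ t in nhds (0 : ℝ), DifferentiableAt ℝ f (x + t • v + t ^ 2 • w) := by
    have h : ∀ᶠ y in nhds x, DifferentiableAt ℝ f y :=
      (hf.eventually (by simp)).mono fun y hy => hy.differentiableAt (by simp)
    have hc := (hγ 0).continuousAt
    rw [ContinuousAt, hγ0] at hc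
    exact hc.eventually h
  have hd : deriv (fun t : ℝ => f (x + t • v + t ^ 2 • w)) =ᶠ[nhds 0]
      fun t => fderiv ℝ f (x + t • v + t ^ 2 • w) (v + (2 * t) • w) :=
    hev.mono fun t ht => (ht.hasFDerivAt.comp_hasDerivAt t (hγ t)).deriv
  have hfd : HasFDerivAt (fderiv ℝ f) (fderiv ℝ (fderiv ℝ f) x) x :=
    ((hf.fderiv_right (m := 1) (by norm_num)).differentiableAt (by simp)).hasFDerivAt
  have hw : HasDerivAt (fun t : ℝ => v + (2 * t) • w) ((2 : ℝ) • w) 0 := by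
    have h := (((hasDerivAt_id (0 : ℝ)).const_mul 2).smul_const w).const_add v
    simpa using h
  constructor
  · rw [hd.eq_of_nhds]
    simp
  · rw [hd.deriv_eq]
    generalize fderiv ℝ f = F at hfd ⊢
    generalize fderiv ℝ F x = F' at hfd ⊢
    have hF : HasDerivAt (fun t : ℝ => F (x + t • v + t ^ 2 • w)) (F' (v + (2 * 0 : ℝ) • w)) 0 :=
      hfd.comp_hasDerivAt_of_eq 0 (hγ 0) hγ0.symm
    rw [(hF.clm_apply hw).deriv]
    simp

/-- Inverse-concavity estimate (Urbas): for `b` symmetric positive definite and any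
symmetric `η`, `D²G(b)(η,η) + 2 DG(b)(η b⁻¹ η) ≥ 2 G(b)⁻¹ (DG(b)(η))²`. -/
theorem inverse_concavity_estimate (n k : ℕ) (hn : 1 ≤ n) (hk1 : 1 ≤ k) (hkn : k ≤ n)
    (b : Matrix (Fin n) (Fin n) ℝ) (hb : b.PosDef)
    (η : Matrix (Fin n) (Fin n) ℝ) (hη : η.IsSymm) :
    2 * (Gfun n k b)⁻¹ * (fderiv ℝ (Gfun n k) b η) ^ 2 ≤
      fderiv ℝ (fderiv ℝ (Gfun n k)) b η η +
        2 * fderiv ℝ (Gfun n k) b (η * b⁻¹ * η) := by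
  obtain ⟨p, hp, h0, h⟩ := exists_polynomial_sk hk1 hkn b hb η hη
  have hb0 : sk n k b = p.eval 0 := by simpa using hp 0
  have hpos : 0 < sk n k b := by rwa [hb0, ← Polynomial.coeff_zero_eq_eval_zero]
  have hG : ContDiffAt ℝ 2 (Gfun n k) b :=
    (contDiff_sk hkn).contDiffAt.rpow_const_of_ne hpos.ne'
  obtain ⟨h1, h2⟩ := deriv_comp_quadratic hG η (η * b⁻¹ * η)
  have key : 2 * (Gfun n k b)⁻¹ *
      deriv (fun t : ℝ => Gfun n k (b + t • η + t ^ 2 • (η * b⁻¹ * η))) 0 ^ 2 ≤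
      deriv (deriv fun t : ℝ => Gfun n k (b + t • η + t ^ 2 • (η * b⁻¹ * η))) 0 := by
    simp only [Gfun, hp, hb0]
    exact rpow_polynomial_second_deriv hk1 p h0 h
  rw [h1, h2] at key
  exact key
end

section
/- Let n ≥ 2 and 1 ≤ k ≤ n−1. For every λ = (λ_1,…,λ_n) ∈ ℝ^n with λ_i > 0 for all i, σ_1(λ) σ_k(λ) − (k+1) σ_{k+1}(λ) ≥ k · (binom(n,k))^{−1/k} · σ_k(λ)^{(k+1)/k}, where binom(n,k) is the binomial coefficient C_n^k. -/
/-- The `k`-th elementary symmetric polynomial of `lam : Fin n → ℝ`. -/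
noncomputable def esymm {n : ℕ} (k : ℕ) (lam : Fin n → ℝ) : ℝ :=
  ∑ t ∈ (Finset.univ : Finset (Fin n)).powersetCard k, ∏ i ∈ t, lam i

/-- The `k`-th elementary symmetric polynomial of the family `f` restricted to the finset `s`. -/
noncomputable def esymmOn {ι : Type*} (s : Finset ι) (k : ℕ) (f : ι → ℝ) : ℝ :=
  ∑ t ∈ s.powersetCard k, ∏ i ∈ t, f i

section esymmOn

variable {ι : Type*} {s : Finset ι} {f : ι → ℝ}

lemma esymmOn_zero : esymmOn s 0 f = 1 := by
  simp [esymmOn]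

lemma esymmOn_one : esymmOn s 1 f = ∑ i ∈ s, f i := by
  simp [esymmOn, Finset.powersetCard_one]

lemma esymmOn_nonneg (hf : ∀ i ∈ s, 0 ≤ f i) (k : ℕ) : 0 ≤ esymmOn s k f :=
  Finset.sum_nonneg fun _ ht => Finset.prod_nonneg fun i hi =>
    hf i ((Finset.mem_powersetCard.1 ht).1 hi)

lemma esymmOn_pos (hf : ∀ i ∈ s, 0 < f i) {k : ℕ} (hk : k ≤ s.card) : 0 < esymmOn s k f :=
  Finset.sum_pos (fun _ ht => Finset.prod_pos fun i hi =>
    hf i ((Finset.mem_powersetCard.1 ht).1 hi)) (Finset.powersetCard_nonempty.2 hk)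

variable [DecidableEq ι]

lemma esymmOn_succ_insert {i : ι} (hi : i ∉ s) (k : ℕ) :
    esymmOn (insert i s) (k + 1) f = esymmOn s (k + 1) f + f i * esymmOn s k f := by
  have hmem : ∀ t ∈ s.powersetCard k, i ∉ t := fun t ht h =>
    hi ((Finset.mem_powersetCard.1 ht).1 h)
  unfold esymmOn
  rw [Finset.powersetCard_succ_insert hi, Finset.sum_union, Finset.sum_image, Finset.mul_sum]
  · exact congrArg _ (Finset.sum_congr rfl fun t ht => Finset.prod_insert (hmem t ht))
  · intro t ht u hu h
    rw [← Finset.erase_insert (hmem t ht), ← Finset.erase_insert (hmem u hu)]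
    exact congrArg (fun v => Finset.erase v i) h
  · refine Finset.disjoint_left.2 fun t ht ht' => ?_
    obtain ⟨u, -, rfl⟩ := Finset.mem_image.1 ht'
    exact hi ((Finset.mem_powersetCard.1 ht).1 (Finset.mem_insert_self i u))

lemma esymmOn_succ_eq_erase {i : ι} (hi : i ∈ s) (k : ℕ) :
    esymmOn s (k + 1) f = esymmOn (s.erase i) (k + 1) f + f i * esymmOn (s.erase i) k f := by
  conv_lhs => rw [← Finset.insert_erase hi]
  exact esymmOn_succ_insert (Finset.notMem_erase i s) k

lemma sum_esymmOn_erase (k : ℕ) :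
    ∑ i ∈ s, esymmOn (s.erase i) k f = ((s.card - k : ℕ) : ℝ) * esymmOn s k f := by
  unfold esymmOn
  rw [Finset.sum_comm' (t' := s.powersetCard k) (s' := fun t => s \ t), Finset.mul_sum]
  · refine Finset.sum_congr rfl fun t ht => ?_
    obtain ⟨hts, rfl⟩ := Finset.mem_powersetCard.1 ht
    rw [Finset.sum_const, Finset.card_sdiff_of_subset hts, nsmul_eq_mul]
  · intro i t
    simp only [Finset.mem_powersetCard, Finset.mem_sdiff, Finset.subset_erase]
    tauto

lemma sum_mul_esymmOn_erase (k : ℕ) :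
    ∑ i ∈ s, f i * esymmOn (s.erase i) k f = ((k : ℝ) + 1) * esymmOn s (k + 1) f := by
  have h : ∑ i ∈ s, f i * esymmOn (s.erase i) k f
      = ∑ i ∈ s, (esymmOn s (k + 1) f - esymmOn (s.erase i) (k + 1) f) :=
    Finset.sum_congr rfl fun i hi => by rw [esymmOn_succ_eq_erase hi k]; ring
  rw [h, Finset.sum_sub_distrib, sum_esymmOn_erase, Finset.sum_const, nsmul_eq_mul]
  rcases le_or_gt (k + 1) s.card with hk | hk
  · rw [Nat.cast_sub hk]
    push_cast
    ring
  · have : esymmOn s (k + 1) f = 0 := by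
      rw [esymmOn, Finset.powersetCard_eq_empty.2 hk, Finset.sum_empty]
    simp [this]

lemma antivaryOn_esymmOn_erase (hf : ∀ i ∈ s, 0 ≤ f i) (k : ℕ) :
    AntivaryOn f (fun i => esymmOn (s.erase i) k f) s := by
  intro i hi j hj hlt
  by_contra! hij
  have hne : i ≠ j := by rintro rfl; exact lt_irrefl _ hij
  refine hlt.not_ge ?_
  cases k with
  | zero => simp [esymmOn_zero]
  | succ k =>
    simp only
    rw [esymmOn_succ_eq_erase (i := i) (Finset.mem_erase.2 ⟨hne, hi⟩),
      esymmOn_succ_eq_erase (i := j) (Finset.mem_erase.2 ⟨hne.symm, hj⟩),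
      Finset.erase_right_comm (a := j)]
    gcongr
    exact esymmOn_nonneg (fun l hl => hf l (Finset.mem_of_mem_erase (Finset.mem_of_mem_erase hl))) k

/-- Newton–MacLaurin inequality between the normalized symmetric functions of orders
`1`, `k` and `k + 1`. -/
lemma card_mul_esymmOn_succ_le (hf : ∀ i ∈ s, 0 ≤ f i) (k : ℕ) :
    (s.card : ℝ) * (((k : ℝ) + 1) * esymmOn s (k + 1) f) ≤
      (∑ i ∈ s, f i) * (((s.card - k : ℕ) : ℝ) * esymmOn s k f) := by
  rw [← sum_mul_esymmOn_erase, ← sum_esymmOn_erase]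
  exact (antivaryOn_esymmOn_erase hf k).card_mul_sum_le_sum_mul_sum

/-- MacLaurin inequality between the arithmetic mean and the `k`-th symmetric mean. -/
lemma esymmOn_le_choose_mul_pow (hs : s.Nonempty) (hf : ∀ i ∈ s, 0 ≤ f i) (k : ℕ) :
    esymmOn s k f ≤ (s.card.choose k : ℝ) * ((∑ i ∈ s, f i) / s.card) ^ k := by
  have hn : (0 : ℝ) < s.card := by exact_mod_cast hs.card_pos
  have hm : 0 ≤ (∑ i ∈ s, f i) / s.card := div_nonneg (Finset.sum_nonneg hf) hn.le
  induction k with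
  | zero => simp [esymmOn_zero]
  | succ k ih =>
    have h := card_mul_esymmOn_succ_le hf k
    have hsum : ∑ i ∈ s, f i = s.card * ((∑ i ∈ s, f i) / s.card) := by field_simp
    generalize (∑ i ∈ s, f i) / s.card = m at *
    rw [hsum, mul_assoc, mul_le_mul_iff_right₀ hn] at h
    have hc : (s.card.choose (k + 1) : ℝ) * ((k : ℝ) + 1)
        = s.card.choose k * ((s.card - k : ℕ) : ℝ) := by
      exact_mod_cast Nat.choose_succ_right_eq s.card k
    refine le_of_mul_le_mul_left (h.trans ?_) (by positivity : (0 : ℝ) < (k : ℝ) + 1)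
    calc m * (((s.card - k : ℕ) : ℝ) * esymmOn s k f)
        ≤ m * (((s.card - k : ℕ) : ℝ) * (s.card.choose k * m ^ k)) := by gcongr
      _ = s.card.choose k * ((s.card - k : ℕ) : ℝ) * m ^ (k + 1) := by ring
      _ = _ := by rw [← hc]; ring

end esymmOn

/-- For `1 ≤ k ≤ n−1` and `λ` with positive entries:
`σ_1(λ) σ_k(λ) − (k+1) σ_{k+1}(λ) ≥ k · binom(n,k)^{−1/k} · σ_k(λ)^{(k+1)/k}`. -/
theorem esymm_newton_maclaurin_estimate (n k : ℕ) (hn : 2 ≤ n) (hk1 : 1 ≤ k)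
    (hkn : k ≤ n - 1) (lam : Fin n → ℝ) (hpos : ∀ i, 0 < lam i) :
    (k : ℝ) * (n.choose k : ℝ) ^ (-(1 / (k : ℝ))) * esymm k lam ^ (((k : ℝ) + 1) / (k : ℝ)) ≤
      esymm 1 lam * esymm k lam - ((k : ℝ) + 1) * esymm (k + 1) lam := by
  have hkn' : k ≤ n := by omega
  have hk : (0 : ℝ) < k := by exact_mod_cast hk1
  have hn0 : (0 : ℝ) < n := by exact_mod_cast (by omega : 0 < n)
  have hC : (0 : ℝ) < n.choose k := by exact_mod_cast Nat.choose_pos hkn'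
  have hE (j : ℕ) : esymm j lam = esymmOn Finset.univ j lam := rfl
  have hne : (Finset.univ : Finset (Fin n)).Nonempty := ⟨⟨0, by omega⟩, Finset.mem_univ _⟩
  have hσ : 0 < esymm k lam := esymmOn_pos (fun i _ => hpos i) (by simpa using hkn')
  have hnewton := card_mul_esymmOn_succ_le (s := Finset.univ) (fun i _ => (hpos i).le) k
  have hmac := esymmOn_le_choose_mul_pow hne (fun i _ => (hpos i).le) k
  have hm : 0 < esymm 1 lam / n :=
    div_pos (esymmOn_pos (fun i _ => hpos i) (by simpa using (by omega : 1 ≤ n))) hn0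
  rw [← esymmOn_one, ← hE, ← hE, Finset.card_univ, Fintype.card_fin] at hmac
  rw [← esymmOn_one, ← hE, ← hE, ← hE, Finset.card_univ, Fintype.card_fin,
    Nat.cast_sub hkn'] at hnewton
  have hroot : (esymm k lam / n.choose k) ^ (1 / (k : ℝ)) ≤ esymm 1 lam / n := by
    rw [one_div, Real.rpow_inv_le_iff_of_pos (by positivity) hm.le hk, Real.rpow_natCast,
      div_le_iff₀' hC]
    exact hmac
  have hlhs : (k : ℝ) * (n.choose k : ℝ) ^ (-(1 / (k : ℝ))) *
      esymm k lam ^ (((k : ℝ) + 1) / (k : ℝ)) =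
      k * esymm k lam * (esymm k lam / n.choose k) ^ (1 / (k : ℝ)) := by
    rw [add_div, div_self hk.ne', Real.rpow_add hσ, Real.rpow_one, Real.rpow_neg hC.le,
      Real.div_rpow hσ.le hC.le]
    ring
  rw [hlhs]
  calc k * esymm k lam * (esymm k lam / n.choose k) ^ (1 / (k : ℝ))
      ≤ k * esymm k lam * (esymm 1 lam / n) := by gcongr
    _ ≤ _ := by
      rw [← mul_div_assoc, div_le_iff₀ hn0]
      linarith
end

section
/- Let (X, μ) be a measure space with μ finite and μ(X) > 0, let β > 0, and let ρ : X → ℝ be a measurable function with ρ > 0 μ-almost everywhere such that ρ, ρ^{−β} and ρ^{1−β} are μ-integrable. Then (∫_X ρ dμ) · (∫_X ρ^{−β} dμ) ≥ μ(X) · (∫_X ρ^{1−β} dμ), with equality if and only if ρ is constant μ-almost everywhere. -/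
open MeasureTheory

/-- For `β > 0`, the functions `t ↦ t` and `t ↦ t ^ (-β)` are strictly oppositely ordered on the
positive reals. -/
theorem sub_mul_rpow_neg_sub_nonneg {β a b : ℝ} (hβ : 0 < β) (ha : 0 < a) (hb : 0 < b) :
    0 ≤ (b - a) * (a ^ (-β) - b ^ (-β)) ∧ ((b - a) * (a ^ (-β) - b ^ (-β)) = 0 → a = b) := by
  rcases lt_trichotomy a b with h | rfl | h
  · have h' := Real.rpow_lt_rpow_of_neg ha h (neg_lt_zero.2 hβ)
    have := mul_pos (sub_pos.2 h) (sub_pos.2 h')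
    exact ⟨this.le, fun h0 => absurd h0 this.ne'⟩
  · simp
  · have h' := Real.rpow_lt_rpow_of_neg hb h (neg_lt_zero.2 hβ)
    have := mul_pos_of_neg_of_neg (sub_neg.2 h) (sub_neg.2 h')
    exact ⟨this.le, fun h0 => absurd h0 this.ne'⟩

/-- Andrews' generalized Hölder (Chebyshev-type) inequality: for a finite measure `μ` with
`μ(X) > 0`, `β > 0` and `ρ > 0` a.e. with the relevant powers integrable,
`(∫ ρ dμ)(∫ ρ^{−β} dμ) ≥ μ(X) ∫ ρ^{1−β} dμ`, with equality iff `ρ` is a.e. constant. -/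
theorem andrews_generalized_holder {X : Type*} [MeasurableSpace X] (μ : Measure X)
    [IsFiniteMeasure μ] (hμ : 0 < μ Set.univ) (β : ℝ) (hβ : 0 < β)
    (ρ : X → ℝ) (hρ : Measurable ρ) (hpos : ∀ᵐ x ∂μ, 0 < ρ x)
    (h1 : Integrable ρ μ)
    (h2 : Integrable (fun x => ρ x ^ (-β)) μ)
    (h3 : Integrable (fun x => ρ x ^ (1 - β)) μ) :
    (μ Set.univ).toReal * ∫ x, ρ x ^ (1 - β) ∂μ ≤
        (∫ x, ρ x ∂μ) * ∫ x, ρ x ^ (-β) ∂μ ∧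
      ((∫ x, ρ x ∂μ) * ∫ x, ρ x ^ (-β) ∂μ =
          (μ Set.univ).toReal * ∫ x, ρ x ^ (1 - β) ∂μ ↔
        ∃ c : ℝ, ρ =ᵐ[μ] fun _ => c) := by
  have hM : 0 < (μ Set.univ).toReal := ENNReal.toReal_pos hμ.ne' (measure_ne_top _ _)
  have hI : 0 < ∫ x, ρ x ∂μ := by
    have hnn : 0 ≤ᵐ[μ] ρ := hpos.mono fun x hx => hx.le
    refine (integral_nonneg_of_ae hnn).lt_of_ne' fun h0 => hμ.ne' ?_
    have h := (integral_eq_zero_iff_of_nonneg_ae hnn h1).1 h0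
    have hF : ∀ᵐ _ ∂μ, False := by
      filter_upwards [hpos, h] with x hx hx0
      exact hx.ne' hx0
    simpa [ae_iff] using hF
  set M := (μ Set.univ).toReal with hM_def
  set m := (∫ x, ρ x ∂μ) / M with hm_def
  have hm : 0 < m := div_pos hI hM
  have hmM : m * M = ∫ x, ρ x ∂μ := div_mul_cancel₀ _ hM.ne'
  let F : X → ℝ := fun x => (m - ρ x) * (ρ x ^ (-β) - m ^ (-β))
  have hF_eq : F =ᵐ[μ] fun x =>
      (m * ρ x ^ (-β) - ρ x ^ (1 - β)) + (m ^ (-β) * ρ x - m * m ^ (-β)) := by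
    filter_upwards [hpos] with x hx
    have h : ρ x ^ (1 - β) = ρ x * ρ x ^ (-β) := by
      rw [sub_eq_add_neg, Real.rpow_add hx, Real.rpow_one]
    simp only [F, h]
    ring
  have hi₁ : Integrable (fun x => m * ρ x ^ (-β) - ρ x ^ (1 - β)) μ :=
    (h2.const_mul m).sub h3
  have hi₂ : Integrable (fun x => m ^ (-β) * ρ x - m * m ^ (-β)) μ :=
    (h1.const_mul (m ^ (-β))).sub (integrable_const _)
  have hF_int : Integrable F μ := (hi₁.add hi₂).congr hF_eq.symm
  have hF_nonneg : 0 ≤ᵐ[μ] F :=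
    hpos.mono fun x hx => (sub_mul_rpow_neg_sub_nonneg hβ hx hm).1
  have hF_integral : ∫ x, F x ∂μ = m * ∫ x, ρ x ^ (-β) ∂μ - ∫ x, ρ x ^ (1 - β) ∂μ := by
    rw [integral_congr_ae hF_eq, integral_add hi₁ hi₂, integral_sub (h2.const_mul m) h3,
      integral_sub (h1.const_mul _) (integrable_const _), integral_const_mul, integral_const_mul,
      integral_const, smul_eq_mul, measureReal_def, ← hM_def, ← hmM]
    ring
  have hkey : (∫ x, ρ x ∂μ) * ∫ x, ρ x ^ (-β) ∂μ - M * ∫ x, ρ x ^ (1 - β) ∂μ =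
      M * ∫ x, F x ∂μ := by
    rw [hF_integral, ← hmM]
    ring
  refine ⟨?_, fun h => ⟨m, ?_⟩, ?_⟩
  · have := mul_nonneg hM.le (integral_nonneg_of_ae hF_nonneg)
    linarith
  · have h0 : ∫ x, F x ∂μ = 0 := by
      rw [h, sub_self] at hkey
      exact (mul_eq_zero.1 hkey.symm).resolve_left hM.ne'
    filter_upwards [hpos, (integral_eq_zero_iff_of_nonneg_ae hF_nonneg hF_int).1 h0]
      with x hx hFx
    exact (sub_mul_rpow_neg_sub_nonneg hβ hx hm).2 hFx
  · rintro ⟨c, hc⟩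
    have hcm : m = c := by
      rw [hm_def, integral_congr_ae hc, integral_const, smul_eq_mul, measureReal_def, ← hM_def,
        mul_div_cancel_left₀ _ hM.ne']
    have hF_zero : F =ᵐ[μ] 0 := hc.mono fun x hx => by simp [F, hx, hcm]
    rw [integral_congr_ae hF_zero] at hkey
    simpa [sub_eq_zero] using hkey
end

section
/- Let n ≥ 1. For all constants C > 0, γ ∈ (0,1) and c > 0, there exists ε > 0, depending only on n, C, γ and c, with the following property: let h : ℝ^{n+1} → ℝ be a convex, even function that is positively 1-homogeneous (h(t y) = t h(y) for all t ≥ 0), differentiable on ℝ^{n+1}∖{0}, and positive on the unit sphere S^n (so h is the support function of an origin-symmetric convex body, evaluated via its 1-homogeneous extension). If ‖∇h(x)‖² − h(x)² ≤ C · h(x)^γ for every unit vector x (this is the gradient estimate |∇_{S^n} u|² ≤ C u^γ for the restriction u of h to S^n, since ∇h(x) is the boundary point with outer normal x and ‖∇h(x)‖² = u(x)² + |∇_{S^n} u(x)|²), and if sup_{‖x‖=1} h(x) ≥ c, then inf_{‖x‖=1} h(x) ≥ ε. -/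
/-- The first-order convexity inequality, in terms of the gradient. -/
theorem ConvexOn.inner_gradient_le {E : Type*} [NormedAddCommGroup E] [InnerProductSpace ℝ E]
    [CompleteSpace E] {f : E → ℝ} (hf : ConvexOn ℝ Set.univ f) {x : E}
    (hd : DifferentiableAt ℝ f x) (z : E) :
    inner ℝ (gradient f x) (z - x) ≤ f z - f x := by
  have hderiv : HasDerivAt (f ∘ AffineMap.lineMap x z) (inner ℝ (gradient f x) (z - x))
      (0 : ℝ) := by
    have hfd : HasFDerivAt f (InnerProductSpace.toDual ℝ E (gradient f x))
        (AffineMap.lineMap x z (0 : ℝ)) := by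
      simpa using hd.hasGradientAt.hasFDerivAt
    simpa using hfd.comp_hasDerivAt (0 : ℝ) AffineMap.hasDerivAt_lineMap
  have hconv : ConvexOn ℝ Set.univ (f ∘ AffineMap.lineMap (k := ℝ) x z) := by
    simpa using hf.comp_affineMap (AffineMap.lineMap (k := ℝ) x z)
  simpa [slope_def_field] using
    hconv.le_slope_of_hasDerivAt (Set.mem_univ _) (Set.mem_univ _) zero_lt_one hderiv

/-- Convex positively 1-homogeneous functions are subadditive. -/
theorem ConvexOn.map_add_le_of_homogeneous {E : Type*} [AddCommGroup E] [Module ℝ E]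
    {f : E → ℝ} (hf : ConvexOn ℝ Set.univ f)
    (hom : ∀ t : ℝ, 0 ≤ t → ∀ y, f (t • y) = t * f y) (a b : E) :
    f (a + b) ≤ f a + f b := by
  have hmid := hf.2 (Set.mem_univ a) (Set.mem_univ b)
    (by norm_num : (0 : ℝ) ≤ 1 / 2) (by norm_num : (0 : ℝ) ≤ 1 / 2) (by norm_num)
  rw [← smul_add, hom _ (by norm_num)] at hmid
  simp only [smul_eq_mul] at hmid
  linarith

/-- A sublinear function that is small at the unit vector `x₀` but not at the unit vector `x₁`
has, at a unit vector near `x₀`, a small value and a gradient bounded below. -/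
theorem exists_small_value_large_gradient {E : Type*} [NormedAddCommGroup E]
    [InnerProductSpace ℝ E] [CompleteSpace E] {h : E → ℝ}
    (hconv : ConvexOn ℝ Set.univ h) (heven : ∀ y, h (-y) = h y)
    (hom : ∀ t : ℝ, 0 ≤ t → ∀ y, h (t • y) = t * h y)
    (hdiff : DifferentiableOn ℝ h ({0}ᶜ : Set E)) {x₀ x₁ : E} (hx₀ : ‖x₀‖ = 1) (hx₁ : ‖x₁‖ = 1)
    {t : ℝ} (ht : 0 < t) (ht' : t ≤ 1 / 16) (hM : 0 < h x₁) (hsmall : h x₀ ≤ t * h x₁ / 4) :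
    ∃ y : E, ‖y‖ = 1 ∧ h y ≤ 4 * t * h x₁ ∧ h x₁ / 2 ≤ ‖gradient h y‖ := by
  set w := x₀ + t • x₁ with hw
  have htx : ‖t • x₁‖ = t := by rw [norm_smul, hx₁, Real.norm_of_nonneg ht.le, mul_one]
  have hr : 1 / 2 ≤ ‖w‖ := by
    have := norm_sub_le w (t • x₁)
    rw [hw, add_sub_cancel_right, ← hw, hx₀, htx] at this
    linarith
  have hr0 : 0 < ‖w‖ := by linarith
  have hw_le : h w ≤ h x₀ + t * h x₁ := by
    simpa [hw, hom t ht.le] using hconv.map_add_le_of_homogeneous hom x₀ (t • x₁)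
  have hw_ge : t * h x₁ - h x₀ ≤ h w := by
    have := hconv.map_add_le_of_homogeneous hom w (-x₀)
    rw [heven, hw, add_neg_cancel_comm, hom t ht.le] at this
    linarith
  have hinv : 0 ≤ ‖w‖⁻¹ := by positivity
  have hy : ‖‖w‖⁻¹ • w‖ = 1 := by
    rw [norm_smul, norm_inv, norm_norm, inv_mul_cancel₀ hr0.ne']
  have htM : 0 < t * h x₁ := by positivity
  refine ⟨‖w‖⁻¹ • w, hy, ?_, ?_⟩
  · rw [hom _ hinv, inv_mul_le_iff₀ hr0]
    nlinarith
  · have hy0 : ‖w‖⁻¹ • w ≠ 0 := by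
      intro h0
      simp [h0] at hy
    have hgrad := hconv.inner_gradient_le
      (hdiff.differentiableAt (isOpen_compl_singleton.mem_nhds hy0)) (‖w‖⁻¹ • x₀)
    have hsub : ‖w‖⁻¹ • x₀ - ‖w‖⁻¹ • w = ‖w‖⁻¹ • (-(t • x₁)) := by
      rw [← smul_sub, hw, sub_add_cancel_left]
    rw [hsub, hom _ hinv, hom _ hinv, inner_smul_right, ← mul_sub,
      mul_le_mul_iff_right₀ (inv_pos.mpr hr0), inner_neg_right, inner_smul_right] at hgrad
    have hcs := real_inner_le_norm (gradient h (‖w‖⁻¹ • w)) x₁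
    rw [hx₁, mul_one] at hcs
    have hcs' := mul_le_mul_of_nonneg_left hcs ht.le
    refine le_of_mul_le_mul_left ?_ ht
    linarith

/-- A threshold `t` below which `C (4 t M) ^ γ` is dominated by `M ^ 2`, uniformly in `M ≥ m`. -/
theorem exists_mul_rpow_le_sq {C γ m : ℝ} (hC : 0 < C) (hγ0 : 0 < γ) (hγ2 : γ < 2) (hm : 0 < m) :
    ∃ t : ℝ, 0 < t ∧ t ≤ 1 / 16 ∧ ∀ M : ℝ, m ≤ M → C * (4 * t * M) ^ γ ≤ M ^ 2 / 8 := by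
  have hpow : 0 < m ^ (2 - γ) / (8 * C) := by positivity
  set s := (m ^ (2 - γ) / (8 * C)) ^ γ⁻¹ with hs
  have hs0 : 0 < s := by positivity
  refine ⟨min (1 / 16) (s / 4), by positivity, min_le_left _ _, fun M hM => ?_⟩
  have hM0 : 0 < M := hm.trans_le hM
  have hle : 4 * min (1 / 16) (s / 4) ≤ s := by linarith [min_le_right (1 / 16) (s / 4)]
  calc C * (4 * min (1 / 16) (s / 4) * M) ^ γ ≤ C * (s * M) ^ γ := by gcongr
    _ = m ^ (2 - γ) * M ^ γ / 8 := by
      rw [Real.mul_rpow hs0.le hM0.le, hs, Real.rpow_inv_rpow hpow.le hγ0.ne']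
      field_simp
    _ ≤ M ^ (2 - γ) * M ^ γ / 8 := by
      have : 0 ≤ 2 - γ := by linarith
      gcongr
    _ = M ^ 2 / 8 := by rw [← Real.rpow_add hM0, sub_add_cancel, Real.rpow_two]

/-- Quantitative lower bound on the support function of an origin-symmetric convex body:
given constants `C > 0`, `γ ∈ (0,1)`, `c > 0`, there is `ε > 0` such that every convex,
even, positively 1-homogeneous `h : ℝ^{n+1} → ℝ`, differentiable off the origin and
positive on the unit sphere, satisfying the gradient estimate
`‖∇h(x)‖² − h(x)² ≤ C·h(x)^γ` on the sphere and `sup_{‖x‖=1} h(x) ≥ c`,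
satisfies `h ≥ ε` on the sphere. -/
theorem support_function_lower_bound (n : ℕ) (C γ c : ℝ)
    (hC : 0 < C) (hγ0 : 0 < γ) (hγ1 : γ < 1) (hc : 0 < c) :
    ∃ ε : ℝ, 0 < ε ∧
      ∀ h : EuclideanSpace ℝ (Fin (n + 1)) → ℝ,
        ConvexOn ℝ Set.univ h →
        (∀ y, h (-y) = h y) →
        (∀ t : ℝ, 0 ≤ t → ∀ y, h (t • y) = t * h y) →
        DifferentiableOn ℝ h ({0}ᶜ : Set (EuclideanSpace ℝ (Fin (n + 1)))) →
        (∀ x : EuclideanSpace ℝ (Fin (n + 1)), ‖x‖ = 1 → 0 < h x) →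
        (∀ x : EuclideanSpace ℝ (Fin (n + 1)), ‖x‖ = 1 →
          ‖gradient h x‖ ^ 2 - h x ^ 2 ≤ C * h x ^ γ) →
        c ≤ ⨆ x : Metric.sphere (0 : EuclideanSpace ℝ (Fin (n + 1))) 1, h x →
        ∀ x : EuclideanSpace ℝ (Fin (n + 1)), ‖x‖ = 1 → ε ≤ h x := by
  obtain ⟨t, ht, ht', hbound⟩ :=
    exists_mul_rpow_le_sq hC hγ0 (hγ1.trans one_lt_two) (half_pos hc)
  refine ⟨t * (c / 2) / 4, by positivity, ?_⟩
  intro h hconv heven hom hdiff hpos hgrad hsup x₀ hx₀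
  by_contra! hlt
  have : Nonempty (Metric.sphere (0 : EuclideanSpace ℝ (Fin (n + 1))) 1) := ⟨x₀, by simpa⟩
  obtain ⟨⟨x₁, hmem⟩, hx₁c⟩ := exists_lt_of_lt_ciSup ((half_lt_self hc).trans_le hsup)
  have hx₁ : ‖x₁‖ = 1 := by simpa using hmem
  have hM : 0 < h x₁ := hpos x₁ hx₁
  have hsmall : h x₀ ≤ t * h x₁ / 4 := by
    refine hlt.le.trans ?_
    gcongr
  obtain ⟨y, hy, hval, hlarge⟩ :=
    exists_small_value_large_gradient hconv heven hom hdiff hx₀ hx₁ ht ht' hM hsmall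
  have hy0 := hpos y hy
  have hrpow : C * h y ^ γ ≤ h x₁ ^ 2 / 8 := by
    refine le_trans ?_ (hbound (h x₁) hx₁c.le)
    gcongr
  have hval' : h y ≤ h x₁ / 4 := hval.trans (by nlinarith)
  have hgrad_sq : (h x₁ / 2) ^ 2 ≤ ‖gradient h y‖ ^ 2 := by gcongr
  have hval_sq : h y ^ 2 ≤ (h x₁ / 4) ^ 2 := by gcongr
  nlinarith [hgrad y hy, pow_pos hM 2]
end
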